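/- arXiv:1203.2112 — 2 statements merged into one kernel-verified Lean document; each statement's English description precedes it below -/
import Mathlib

section
/- Let (x_{k,l})_{k+l ≤ n+1} be integers, with conventions x_{m,0} = 0 and x_{k,l} = 0 whenever k+l > n+1, and let t be an indeterminate. Substitute c_{k,l} = t^{x_{k,l}} in Θ(c). Then for every 1 ≤ j ≤ n: (i) the minor of Θ(t^x) on rows {n+2−j,…,n+1} and columns {1,…,j−1,j+1} is a nonzero Laurent polynomial in t whose lowest exponent (order of vanishing at t = 0) equals min_{1≤k≤j} ( x_{n−j+1,k} − x_{n−j+2,k−1} ); and (ii) the minor of Θ(t^x) on rows {j} ∪ {j+2,…,n+1} and columns {1,…,n+1−j} is a nonzero Laurent polynomial in t whose lowest exponent equals min_{1≤k≤j} ( x_{j−k+1,k−1} − x_{j−k+1,k} ). These are the ultra-discretizations UD(Δ_{w₀Λ_j,s_jΛ_j}∘Θ) and UD(Δ_{w₀s_jΛ_j,Λ_j}∘Θ). -/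
open Matrix

variable (K : Type*) [Field K]

/-- The matrix unit `E_{k,l}` in 1-based indexing (zero matrix if out of range). -/
def Em (n k l : ℕ) : Matrix (Fin (n+1)) (Fin (n+1)) K :=
  Matrix.of fun a b => if (a : ℕ) + 1 = k ∧ (b : ℕ) + 1 = l then 1 else 0

/-- The lower unipotent one-parameter element `y_i(c) = I + c E_{i+1,i}` (1-based `i`). -/
noncomputable def ym (n i : ℕ) (c : K) : Matrix (Fin (n+1)) (Fin (n+1)) K :=
  1 + c • Em K n (i+1) i

/-- The coweight torus element `α_i^∨(c)` (1-based `i`). -/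
noncomputable def alco (n i : ℕ) (c : K) : Matrix (Fin (n+1)) (Fin (n+1)) K :=
  Matrix.diagonal fun a => if (a : ℕ) + 1 = i then c else if (a : ℕ) + 1 = i + 1 then c⁻¹ else 1

/-- `𝐲_i(c) = y_i(c) · α_i^∨(c⁻¹)`. -/
noncomputable def Yb (n i : ℕ) (c : K) : Matrix (Fin (n+1)) (Fin (n+1)) K :=
  ym K n i c * alco K n i c⁻¹

/-- `Θ(c) = ∏_{k=1}^{n} ( 𝐲_1(c_{k,1}) ⋯ 𝐲_{n+1−k}(c_{k,n+1−k}) )`, product in increasing `k`. -/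
noncomputable def Theta (n : ℕ) (c : ℕ → ℕ → K) : Matrix (Fin (n+1)) (Fin (n+1)) K :=
  ((List.range n).map fun k =>
    ((List.range (n - k)).map fun l => Yb K n (l+1) (c (k+1) (l+1))).prod).prod


section Helpers
variable {K}

/-- Elementary operator on sequences (0-based index). -/
def Yo (l : ℕ) (c : K) : Module.End K (ℕ → K) where
  toFun v := fun a => if a = l then c⁻¹ * v l else if a = l + 1 then v l + c * v (l+1) else v a
  map_add' u v := by
    funext a; simp only [Pi.add_apply]; split_ifs <;> ring
  map_smul' r v := by
    funext a; simp only [Pi.smul_apply, smul_eq_mul, RingHom.id_apply]; split_ifs <;> ring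

theorem Yo_apply (l : ℕ) (c : K) (v : ℕ → K) (a : ℕ) : Yo l c v a =
    if a = l then c⁻¹ * v l else if a = l + 1 then v l + c * v (l+1) else v a := rfl

/-- Sign operator. -/
def sgo : Module.End K (ℕ → K) where
  toFun v := fun a => (-1) ^ a * v a
  map_add' u v := by
    funext a; simp only [Pi.add_apply]; ring
  map_smul' r v := by
    funext a; simp only [Pi.smul_apply, smul_eq_mul, RingHom.id_apply]; ring

theorem sgo_apply (v : ℕ → K) (a : ℕ) : sgo v a = (-1) ^ a * v a := rfl

theorem Yo_sgo (l : ℕ) (c : K) (hc : c ≠ 0) : Yo l c * (sgo * Yo l c⁻¹) = sgo := by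
  ext1 v
  funext a
  simp only [Module.End.mul_apply, Yo_apply, sgo_apply]
  by_cases h : a = l
  · subst h; simp; field_simp
  · by_cases h2 : a = l + 1
    · subst h2; simp; field_simp; ring
    · simp [h, h2]

theorem Yo_comm (l m : ℕ) (h : l + 2 ≤ m) (c d : K) : Commute (Yo l c) (Yo m d) := by
  ext1 v
  funext a
  simp only [Module.End.mul_apply, Yo_apply]
  have h1 : l ≠ m := by omega
  have h2 : l ≠ m + 1 := by omega
  have h3 : l + 1 ≠ m := by omega
  have h4 : l + 1 ≠ m + 1 := by omega
  have h5 : m + 1 ≠ l := by omega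
  have h6 : m + 1 ≠ l + 1 := by omega
  by_cases e1 : a = l
  · subst e1; simp [h1, h2]
  · by_cases e2 : a = l + 1
    · subst e2; simp [h1, h2, h3]
    · simp [e1, e2, h1.symm, h3.symm, h5]

/-- Row operator. -/
def Bop : ℕ → (ℕ → K) → Module.End K (ℕ → K)
  | 0, _ => 1
  | m+1, g => Bop m g * Yo m (g (m+1))

/-- The sequence version of Theta. -/
def Th : ℕ → (ℕ → ℕ → K) → Module.End K (ℕ → K)
  | 0, _ => 1
  | n+1, c => Bop (n+1) (c 1) * Th n (fun k => c (k+1))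

/-- The regrouped factor. -/
def Do : ℕ → (ℕ → ℕ → K) → Module.End K (ℕ → K)
  | 0, _ => 1
  | m+1, c => Yo m (c 1 (m+1)) * Do m (fun k => c (k+1))

theorem Bop_comm (m r : ℕ) (h : m + 1 ≤ r) (g : ℕ → K) (d : K) : Commute (Bop m g) (Yo r d) := by
  induction m with
  | zero => exact Commute.one_left _
  | succ m ih => exact (ih (by omega)).mul_left (Yo_comm _ _ (by omega) _ _)

theorem Th_comm (n r : ℕ) (h : n + 1 ≤ r) (c : ℕ → ℕ → K) (d : K) : Commute (Th n c) (Yo r d) := by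
  induction n generalizing c with
  | zero => exact Commute.one_left _
  | succ m ih => exact (Bop_comm _ _ (by omega) _ _).mul_left (ih (by omega) _)

theorem Th_right (n : ℕ) (c : ℕ → ℕ → K) : Th (n+1) c = Th n c * Do (n+1) c := by
  induction n generalizing c with
  | zero => simp [Th, Do, Bop]
  | succ n ih =>
    have h1 : Th (n+2) c = Bop (n+2) (c 1) * Th (n+1) (fun k => c (k+1)) := rfl
    have h2 : Bop (n+2) (c 1) = Bop (n+1) (c 1) * Yo (n+1) (c 1 (n+2)) := rfl
    have h3 : Th (n+1) c = Bop (n+1) (c 1) * Th n (fun k => c (k+1)) := rfl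
    have h4 : Do (n+2) c = Yo (n+1) (c 1 (n+2)) * Do (n+1) (fun k => c (k+1)) := rfl
    have h5 := (Th_comm n (n+1) le_rfl (fun k => c (k+1)) (c 1 (n+2))).eq
    rw [h1, ih, h2, h3, h4]
    simp only [mul_assoc]
    rw [← mul_assoc (Yo _ _) (Th _ _), ← h5]
    simp only [mul_assoc]

theorem Do_sgo (m : ℕ) (c : ℕ → ℕ → K) (hc : ∀ k l, c k l ≠ 0) (g : ℕ → K)
    (hg : ∀ l, 1 ≤ l → l ≤ m → g l = (c (m+1-l) l)⁻¹) : Do m c * (sgo * Bop m g) = sgo := by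
  induction m generalizing c with
  | zero => simp [Do, Bop]
  | succ m ih =>
    have h1 : Bop (m+1) g = Bop m g * Yo m (g (m+1)) := rfl
    have h2 : Do (m+1) c = Yo m (c 1 (m+1)) * Do m (fun k => c (k+1)) := rfl
    have h3 := ih (fun k => c (k+1)) (fun _ _ => hc _ _) (by
      intro l hl hlm
      rw [hg l hl (by omega)]
      congr 3
      omega)
    have h4 : g (m+1) = (c 1 (m+1))⁻¹ := by
      rw [hg (m+1) (by omega) le_rfl]; congr 3; omega
    rw [h1, h2, h4, ← mul_assoc sgo, mul_assoc, ← mul_assoc (Do _ _), h3, Yo_sgo _ _ (hc _ _)]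

theorem Th_sgo (n : ℕ) (c : ℕ → ℕ → K) (hc : ∀ k l, c k l ≠ 0) (d : ℕ → ℕ → K)
    (hd : ∀ k l, 1 ≤ k → 1 ≤ l → k + l ≤ n + 1 → d k l = (c (n+2-k-l) l)⁻¹) :
    Th n c * (sgo * Th n d) = sgo := by
  induction n generalizing d with
  | zero => simp [Th]
  | succ n ih =>
    have h1 : Th (n+1) d = Bop (n+1) (d 1) * Th n (fun k => d (k+1)) := rfl
    have h2 := ih (fun k => d (k+1)) (by
      intro k l hk hl hkl
      rw [hd _ _ (by omega) hl (by omega)]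
      congr 3
      omega)
    have h3 := Do_sgo (n+1) c hc (d 1) (by
      intro l hl hlm
      rw [hd _ _ le_rfl hl (by omega)]
      congr 3)
    rw [Th_right, h1, ← mul_assoc sgo, mul_assoc, ← mul_assoc (Do _ _), h3, h2]

theorem Bop_apply' (m : ℕ) (g : ℕ → K) (h0 : g 0 = 1) (hg : ∀ l, g l ≠ 0) (v : ℕ → K) (a : ℕ) :
    Bop m g v a = (if a < m then g a / g (a+1) * v a else if a = m then g a * v a else v a)
      + (if 1 ≤ a ∧ a ≤ m then v (a-1) else 0) := by
  induction m generalizing v with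
  | zero =>
    by_cases h : a = 0
    · subst h; simp [Bop, h0]
    · have : ¬ (1 ≤ a ∧ a ≤ 0) := by omega
      simp [Bop, h]
  | succ m ih =>
    have h1 : Bop (m+1) g v = Bop m g (Yo m (g (m+1)) v) := rfl
    rw [h1, ih]
    simp only [Yo_apply]
    rcases lt_trichotomy a m with h | h | h
    · have e1 : a ≠ m := by omega
      have e2 : a ≠ m + 1 := by omega
      have e3 : a - 1 ≠ m := by omega
      have e4 : a - 1 ≠ m + 1 := by omega
      have e5 : a < m + 1 := by omega
      have e6 : a ≤ m := by omega
      have e7 : a ≤ m + 1 := by omega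
      simp [h, e1, e2, e3, e4, e5, e6, e7]
    · subst h
      by_cases ha : a = 0
      · subst ha; simp [h0]
      · have e3 : a - 1 ≠ a := by omega
        have e4 : a - 1 ≠ a + 1 := by omega
        simp [e3, e4]
        field_simp
    · by_cases h2 : a = m + 1
      · subst h2; simp; ring
      · have e1 : ¬ a < m := by omega
        have e2 : a ≠ m := by omega
        have e3 : ¬ a < m + 1 := by omega
        have e4 : ¬ a ≤ m := by omega
        have e5 : ¬ a ≤ m + 1 := by omega
        simp [h2, e1, e2, e3, e4, e5]

theorem Bop_apply (m : ℕ) (g : ℕ → K) (h0 : g 0 = 1) (hg : ∀ l, g l ≠ 0)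
    (h1 : ∀ l, m < l → g l = 1) (v : ℕ → K) (a : ℕ) :
    Bop m g v a = g a / g (a+1) * v a + (if 1 ≤ a ∧ a ≤ m then v (a-1) else 0) := by
  rw [Bop_apply' m g h0 hg]
  congr 1
  split_ifs with h h2
  · rfl
  · subst h2; rw [h1 (a+1) (by omega)]; simp
  · rw [h1 (a+1) (by omega), h1 a (by omega)]; simp

/-- Solving the bidiagonal system. -/
theorem Bop_solve (m : ℕ) (g : ℕ → K) (h0 : g 0 = 1) (hg : ∀ l, g l ≠ 0)
    (h1 : ∀ l, m < l → g l = 1) (w : ℕ → K) :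
    ∃ v, Bop m g v = w ∧ (∀ a, m < a → v a = w a) ∧
      ∀ a, a ≤ m → v a = (-1) ^ a * g (a+1) * ∑ l ∈ Finset.range (a+1), (-1) ^ l * w l / g l := by
  refine ⟨fun a => if m < a then w a else
    (-1) ^ a * g (a+1) * ∑ l ∈ Finset.range (a+1), (-1) ^ l * w l / g l, ?_, ?_, ?_⟩
  · funext a
    rw [Bop_apply m g h0 hg h1]
    by_cases h : m < a
    · have : ¬ (a ≤ m) := by omega
      simp [h, this, h1 a h, h1 (a+1) (by omega)]
    · rcases Nat.eq_zero_or_pos a with ha | ha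
      · subst ha; simp [h0, hg]
      · obtain ⟨b, rfl⟩ : ∃ b, a = b + 1 := ⟨a - 1, by omega⟩
        have e1 : b + 1 ≤ m := by omega
        have e2 : ¬ m < b := by omega
        have e3 := hg (b+1)
        have e4 := hg (b+1+1)
        simp only [h, e1, e2, if_false, add_tsub_cancel_right, le_add_iff_nonneg_left, zero_le,
          and_self, if_true]
        rw [Finset.sum_range_succ _ (b+1)]
        field_simp
        have : ((-1 : K) ^ (b+1)) * (-1) ^ (b+1) = 1 := by rw [← mul_pow]; simp
        rw [mul_add]
        linear_combination w (b+1) * this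
  · intro a h; simp [h]
  · intro a h; simp [not_lt.mpr h]

/-- Conventions for the parameters. -/
def Conv (n : ℕ) (c : ℕ → ℕ → K) : Prop :=
  (∀ k, c k 0 = 1) ∧ (∀ k l, c k l ≠ 0) ∧ (∀ k l, 1 ≤ k → n + 1 < k + l → c k l = 1)

theorem Conv.shift {n : ℕ} {c : ℕ → ℕ → K} (h : Conv (n+1) c) : Conv n (fun k => c (k+1)) :=
  ⟨fun _ => h.1 _, fun _ _ => h.2.1 _ _, fun k l hk hkl => h.2.2 (k+1) l (by omega) (by omega)⟩

theorem Conv.bop {n : ℕ} {c : ℕ → ℕ → K} (h : Conv (n+1) c) (v : ℕ → K) (a : ℕ) :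
    Bop (n+1) (c 1) v a =
      c 1 a / c 1 (a+1) * v a + (if 1 ≤ a ∧ a ≤ n+1 then v (a-1) else 0) :=
  Bop_apply _ _ (h.1 1) (h.2.1 1) (fun l hl => h.2.2 1 l le_rfl (by omega)) v a

theorem Th_solve (n : ℕ) (c : ℕ → ℕ → K) (h : Conv n c) (w : ℕ → K) :
    ∃ u, Th n c u = w ∧ (∀ a, n < a → u a = w a) ∧
      u n = (-1) ^ n * ∑ l ∈ Finset.range (n+1), (-1) ^ l * w l / c 1 l := by
  induction n generalizing c w with
  | zero => exact ⟨w, rfl, fun _ _ => rfl, by simp [h.1]⟩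
  | succ n ih =>
    obtain ⟨v, hv, hv1, hv2⟩ := Bop_solve (n+1) (c 1) (h.1 1) (h.2.1 1)
      (fun l hl => h.2.2 1 l le_rfl (by omega)) w
    obtain ⟨u, hu, hu1, -⟩ := ih _ h.shift v
    refine ⟨u, ?_, ?_, ?_⟩
    · change Bop (n+1) (c 1) (Th n _ u) = w
      rw [hu, hv]
    · intro a ha; rw [hu1 a (by omega), hv1 a ha]
    · rw [hu1 (n+1) (by omega), hv2 (n+1) le_rfl, h.2.2 1 (n+1+1) le_rfl (by omega), mul_one]

theorem Th_vec (r j : ℕ) (hj : 1 ≤ j) (c : ℕ → ℕ → K) (h : Conv (j + r) c) :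
    ∃ u, u j = (-1) ^ j ∧
      u (j-1) = (-1) ^ (j-1) * ∑ k ∈ Finset.Icc 1 j, c (r+1) k / c (r+2) (k-1) ∧
      (∀ a, j < a → u a = 0) ∧ (∀ a, r < a → Th (j+r) c u a = 0) := by
  induction r generalizing c with
  | zero =>
    obtain ⟨s, rfl⟩ : ∃ s, j = s + 1 := ⟨j - 1, by omega⟩
    obtain ⟨v, hv, hv1, hv2⟩ := Bop_solve (s+1) (c 1) (h.1 1) (h.2.1 1)
      (fun l hl => h.2.2 1 l le_rfl (by omega)) (Pi.single 0 1)
    obtain ⟨u, hu, hu1, hu2⟩ := Th_solve s _ h.shift v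
    have hv3 : ∀ a, a ≤ s + 1 → v a = (-1) ^ a * c 1 (a+1) := by
      intro a ha
      rw [hv2 a ha, Finset.sum_range_succ', Finset.sum_eq_zero]
      · simp [h.1]
      · intro i _; simp
    refine ⟨u, ?_, ?_, ?_, ?_⟩
    · rw [hu1 _ (by omega), hv3 _ le_rfl, h.2.2 1 _ le_rfl (by omega), mul_one]
    · rw [Nat.add_sub_cancel, hu2]
      congr 1
      rw [← Finset.Ico_add_one_right_eq_Icc, Finset.sum_Ico_eq_sum_range]
      apply Finset.sum_congr (by simp)
      intro l hl
      have hl := Finset.mem_range.mp hl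
      rw [hv3 l (by omega), ← mul_assoc, ← mul_pow]
      simp [add_comm]
    · intro a ha
      rw [hu1 a (by omega), hv1 a ha]
      exact Pi.single_eq_of_ne (by omega) _
    · intro a ha
      change Bop (s+1) (c 1) (Th s _ u) a = 0
      rw [hu, hv]
      exact Pi.single_eq_of_ne (by omega) _
  | succ r ih =>
    obtain ⟨u, h1, h2, h3, h4⟩ := ih _ (Conv.shift (n := j + r) h)
    refine ⟨u, h1, h2, h3, ?_⟩
    intro a ha
    change Bop (j+r+1) (c 1) (Th (j+r) _ u) a = 0
    rw [Conv.bop (n := j + r) h, h4 a (by omega), h4 (a-1) (by omega)]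
    simp

theorem Th_lower (n : ℕ) (c : ℕ → ℕ → K) (h : Conv n c) (a b : ℕ) (hab : a < b) :
    Th n c (Pi.single b 1) a = 0 := by
  induction n generalizing c a with
  | zero => exact Pi.single_eq_of_ne (by omega) _
  | succ n ih =>
    change Bop (n+1) (c 1) (Th n _ _) a = 0
    rw [h.bop, ih _ h.shift a hab, ih _ h.shift (a-1) (by omega)]
    simp

theorem Th_high (n : ℕ) (c : ℕ → ℕ → K) (h : Conv n c) (v : ℕ → K) (a : ℕ) (ha : n < a) :
    Th n c v a = v a := by
  induction n generalizing c with
  | zero => rfl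
  | succ n ih =>
    change Bop (n+1) (c 1) (Th n _ _) a = _
    have : ¬ (1 ≤ a ∧ a ≤ n + 1) := by omega
    rw [h.bop, ih _ h.shift (by omega), if_neg this, h.2.2 1 a le_rfl (by omega),
      h.2.2 1 (a+1) le_rfl (by omega)]
    simp

theorem prod_tele (f : ℕ → K) (hf : ∀ i, f i ≠ 0) (n : ℕ) :
    ∏ i ∈ Finset.range n, f i / f (i+1) = f 0 / f n := by
  induction n with
  | zero => simp [hf]
  | succ n ih =>
    have := hf n
    have := hf (n+1)
    rw [Finset.prod_range_succ, ih]; field_simp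

theorem Th_diag (n : ℕ) (c : ℕ → ℕ → K) (h : Conv n c) :
    ∏ a ∈ Finset.range (n+1), Th n c (Pi.single a 1) a = 1 := by
  induction n generalizing c with
  | zero => simp [Th]
  | succ n ih =>
    have h1 : ∀ a, Th (n+1) c (Pi.single a 1) a =
        c 1 a / c 1 (a+1) * Th n (fun k => c (k+1)) (Pi.single a 1) a := by
      intro a
      change Bop (n+1) (c 1) (Th n _ _) a = _
      rw [h.bop]
      split_ifs with ha
      · rw [Th_lower n _ h.shift (a-1) a (by omega), add_zero]
      · rw [add_zero]
    rw [Finset.prod_congr rfl (fun a _ => h1 a), Finset.prod_mul_distrib,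
      Finset.prod_range_succ (fun a => Th n _ _ a), ih _ h.shift, Th_high n _ h.shift _ _ (by omega),
      prod_tele (fun a => c 1 a) (h.2.1 1), h.1, h.2.2 1 _ le_rfl (by omega)]
    simp

theorem Th_minor (n j : ℕ) (hj : j ≤ n + 1) (c : ℕ → ℕ → K) (h : Conv n c) :
    (Matrix.of fun a b : Fin j => Th n c (Pi.single (b : ℕ) 1) (n + 1 - j + a)).det = 1 := by
  induction n generalizing c with
  | zero =>
    interval_cases j
    · simp
    · simp [Th]
  | succ n ih =>
    rcases Nat.lt_or_ge (n+1) j with h2 | h2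
    · obtain rfl : j = n + 2 := by omega
      rw [Matrix.det_of_isLowerTriangular]
      · have := Th_diag (n+1) c h
        rw [Finset.prod_range] at this
        simpa using this
      · intro a b hab
        have hab : a < b := hab
        simpa using Th_lower (n+1) c h a b (by simpa using hab)
    · have key : (Matrix.of fun a b : Fin j => Th (n+1) c (Pi.single (b : ℕ) 1) (n + 1 + 1 - j + a))
        = (Matrix.of fun a b : Fin j => if b = a then (1 : K) else if (b : ℕ) = a + 1 then
            c 1 (n + 1 + 1 - j + a) / c 1 (n + 1 + 1 - j + a + 1) else 0) *
          (Matrix.of fun a b : Fin j =>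
            Th n (fun k => c (k+1)) (Pi.single (b : ℕ) 1) (n + 1 - j + a)) := by
        ext a b
        rw [Matrix.mul_apply]
        simp only [Matrix.of_apply]
        change Bop (n+1) (c 1) (Th n _ _) _ = _
        have ha := a.isLt
        have hb := b.isLt
        rw [h.bop, if_pos ⟨by omega, by omega⟩]
        have e1 : n + 1 + 1 - j + (a : ℕ) - 1 = n + 1 - j + a := by omega
        rw [e1]
        by_cases hl : (a : ℕ) + 1 < j
        · rw [Finset.sum_eq_add (a := a) (b := ⟨a + 1, hl⟩)]
          · have : (⟨(a : ℕ) + 1, hl⟩ : Fin j) ≠ a := by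
              intro hh; have := congrArg Fin.val hh; simp at this
            simp only [this, if_true, if_false]
            have e2 : n + 1 + 1 - j + (a : ℕ) = n + 1 - j + (a + 1) := by omega
            rw [e2]; ring
          · intro hh; have := congrArg Fin.val hh; simp at this
          · intro i _ hi
            rw [if_neg hi.1, if_neg, zero_mul]
            intro hh; exact hi.2 (Fin.ext hh)
          · simp
          · simp
        · rw [Finset.sum_eq_single a]
          · have e2 : n + 1 + 1 - j + (a : ℕ) = n + 1 := by omega
            rw [e2, Th_high n _ h.shift _ _ (by omega), Pi.single_eq_of_ne (by omega)]
            simp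
          · intro i _ hi
            have := i.isLt
            rw [if_neg hi, if_neg (by omega), zero_mul]
          · simp
      rw [key, Matrix.det_mul, ih h2 _ h.shift, mul_one, Matrix.det_of_isUpperTriangular]
      · simp
      · intro a b hab
        have hab : b < a := hab
        have h3 : (b : ℕ) < a := hab
        simp only [Matrix.of_apply]
        rw [if_neg hab.ne, if_neg (by omega)]

theorem Yb_mulVec (n l : ℕ) (c : K) (hc : c ≠ 0) (v : ℕ → K) (a : Fin (n+1)) :
    (Yb K n (l+1) c *ᵥ fun b : Fin (n+1) => v b) a = Yo l c v a := by
  have h1 : (alco K n (l+1) c⁻¹ *ᵥ fun b : Fin (n+1) => v b) = fun b : Fin (n+1) =>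
      (if (b : ℕ) = l then c⁻¹ else if (b : ℕ) = l + 1 then c else 1) * v b := by
    funext b
    simp [alco, Matrix.mulVec_diagonal]
  rw [Yb, ← Matrix.mulVec_mulVec, h1, ym, Matrix.add_mulVec, Matrix.one_mulVec, Pi.add_apply,
    Matrix.smul_mulVec, Pi.smul_apply, Yo_apply]
  have h2 : (Em K n (l+1+1) (l+1) *ᵥ fun b : Fin (n+1) =>
      (if (b : ℕ) = l then c⁻¹ else if (b : ℕ) = l + 1 then c else 1) * v b) a =
      if (a : ℕ) = l + 1 then c⁻¹ * v l else 0 := by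
    simp only [Matrix.mulVec, dotProduct, Em, Matrix.of_apply]
    have ha := a.isLt
    by_cases h : (a : ℕ) = l + 1
    · rw [Finset.sum_eq_single (⟨l, by omega⟩ : Fin (n+1))]
      · simp [h]
      · intro b _ hb
        have : (b : ℕ) ≠ l := fun hh => hb (Fin.ext hh)
        simp [this]
      · simp
    · simp [h]
  rw [h2]
  by_cases e1 : (a : ℕ) = l
  · simp [e1]
  · by_cases e2 : (a : ℕ) = l + 1
    · simp [e2]; field_simp; ring
    · simp [e1, e2]

theorem Bop_mulVec (n m : ℕ) (g : ℕ → K) (hg : ∀ l, g l ≠ 0) (v : ℕ → K) :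
    (((List.range m).map fun l => Yb K n (l+1) (g (l+1))).prod *ᵥ fun b : Fin (n+1) => v b)
      = fun a : Fin (n+1) => Bop m g v a := by
  induction m generalizing v with
  | zero => simp [Bop]
  | succ m ih =>
    rw [List.range_succ, List.map_append, List.prod_append, ← Matrix.mulVec_mulVec]
    have : (((List.map (fun l => Yb K n (l+1) (g (l+1))) [m]).prod) *ᵥ fun b : Fin (n+1) => v b)
        = fun b : Fin (n+1) => Yo m (g (m+1)) v b := by
      funext a
      simpa using Yb_mulVec n m (g (m+1)) (hg _) v a
    rw [this, ih]
    rfl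

theorem Th_mulVec (n m : ℕ) (c : ℕ → ℕ → K) (hc : ∀ k l, c k l ≠ 0) (v : ℕ → K) :
    (((List.range m).map fun k =>
      ((List.range (m - k)).map fun l => Yb K n (l+1) (c (k+1) (l+1))).prod).prod *ᵥ
        fun b : Fin (n+1) => v b) = fun a : Fin (n+1) => Th m c v a := by
  induction m generalizing c with
  | zero => simp [Th]
  | succ m ih =>
    rw [List.range_succ_eq_map, List.map_cons, List.prod_cons, ← Matrix.mulVec_mulVec,
      List.map_map]
    have := ih (fun k => c (k+1)) (fun _ _ => hc _ _)
    have e : ((fun k => ((List.range (m + 1 - k)).map fun l =>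
        Yb K n (l+1) (c (k+1) (l+1))).prod) ∘ Nat.succ) = fun k =>
        ((List.range (m - k)).map fun l => Yb K n (l+1) (c (k+1+1) (l+1))).prod := by
      funext k
      simp
    rw [e, this, Bop_mulVec n _ (c 1) (hc 1)]
    rfl

theorem Theta_entry (n : ℕ) (c : ℕ → ℕ → K) (hc : ∀ k l, c k l ≠ 0) (a b : Fin (n+1)) :
    Theta K n c a b = Th n c (Pi.single (b : ℕ) 1) a := by
  have := congrFun (Th_mulVec n n c hc (Pi.single (b : ℕ) 1)) a
  rw [← this]
  have e : (fun i : Fin (n+1) => (Pi.single (b : ℕ) 1 : ℕ → K) i) = Pi.single b 1 := by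
    funext i
    simp [Pi.single_apply, Fin.ext_iff]
  rw [e, Matrix.mulVec_single_one]
  rfl

theorem Th_sum (n m : ℕ) (hm : m ≤ n + 1) (c : ℕ → ℕ → K) (hc : ∀ k l, c k l ≠ 0) (v : ℕ → K)
    (hv : ∀ b, m ≤ b → v b = 0) (a : ℕ) (ha : a < n + 1) :
    Th n c v a = ∑ b ∈ Finset.range m, Th n c (Pi.single b 1) a * v b := by
  have h1 := congrFun (Th_mulVec n n c hc v) ⟨a, ha⟩
  have h2 : ∀ b : Fin (n+1), Theta K n c ⟨a, ha⟩ b * v b =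
      (fun b : ℕ => Th n c (Pi.single b 1) a * v b) b := by
    intro b; rw [Theta_entry n c hc]
  have h3 : Th n c v a = ∑ b : Fin (n+1), Theta K n c ⟨a, ha⟩ b * v b := h1.symm
  rw [h3, Finset.sum_congr rfl (fun b _ => h2 b), ← Finset.sum_range (fun b : ℕ => Th n c (Pi.single b 1) a * v b)]
  symm
  apply Finset.sum_subset
  · intro i hi; simp at hi ⊢; omega
  · intro i _ hi
    simp at hi
    rw [hv i hi, mul_zero]

theorem det_col {m : ℕ} (M : Matrix (Fin m) (Fin m) K) (i : Fin m) (w : Fin m → K) :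
    (M.updateCol i (M *ᵥ w)).det = M.det * w i := by
  rw [← Matrix.cramer_apply, Matrix.cramer_eq_adjugate_mulVec, Matrix.mulVec_mulVec,
    Matrix.adjugate_mul, Matrix.smul_mulVec, Matrix.one_mulVec]
  rfl

theorem det_row {m : ℕ} (M N : Matrix (Fin m) (Fin m) K) (i : Fin m) (z : Fin m → K) (s : K)
    (hN : ∀ a, a ≠ i → N a = M a) (h1 : M *ᵥ z = Pi.single i 1) (h2 : N *ᵥ z = s • Pi.single i 1) :
    N.det = s * M.det := by
  have hadj : N.adjugate *ᵥ Pi.single i 1 = M.adjugate *ᵥ Pi.single i 1 := by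
    rw [Matrix.mulVec_single_one, Matrix.mulVec_single_one]
    funext k
    simp only [Matrix.col_apply]
    rw [Matrix.adjugate_apply, Matrix.adjugate_apply]
    congr 1
    ext a b
    by_cases h : a = i
    · subst h; simp
    · simp [Matrix.updateRow_ne h, hN a h]
  have hM : M.adjugate *ᵥ (M *ᵥ z) = M.det • z := by
    rw [Matrix.mulVec_mulVec, Matrix.adjugate_mul, Matrix.smul_mulVec, Matrix.one_mulVec]
  have hN' : N.adjugate *ᵥ (N *ᵥ z) = N.det • z := by
    rw [Matrix.mulVec_mulVec, Matrix.adjugate_mul, Matrix.smul_mulVec, Matrix.one_mulVec]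
  rw [h2, Matrix.mulVec_smul, hadj, ← h1, hM, smul_smul] at hN'
  have hz : z ≠ 0 := by
    rintro rfl
    rw [Matrix.mulVec_zero] at h1
    have := congrFun h1 i
    simp at this
  obtain ⟨k, hk⟩ := Function.ne_iff.mp hz
  have := congrFun hN' k
  simp only [Pi.smul_apply, smul_eq_mul] at this
  exact (mul_right_cancel₀ hk this).symm

theorem minor_one (n j : ℕ) (hj : 1 ≤ j) (hjn : j ≤ n) (c : ℕ → ℕ → K) (h : Conv n c)
    (f g : Fin j → Fin (n+1)) (hf : ∀ a, (f a : ℕ) = n + 1 - j + a)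
    (hg : ∀ a, (g a : ℕ) = if (a : ℕ) = j - 1 then j else a) :
    ((Theta K n c).submatrix f g).det =
      ∑ k ∈ Finset.Icc 1 j, c (n-j+1) k / c (n-j+2) (k-1) := by
  obtain ⟨r, rfl⟩ : ∃ r, n = j + r := ⟨n - j, by omega⟩
  obtain ⟨u, hu1, hu2, hu3, hu4⟩ := Th_vec r j hj c h
  set M := (Matrix.of fun a b : Fin j =>
    Th (j+r) c (Pi.single (b : ℕ) 1) (j + r + 1 - j + a)) with hM
  have hj0 : j - 1 < j := by omega
  have hdet : M.det = 1 := Th_minor (j+r) j (by omega) c h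
  have key : (Theta K (j+r) c).submatrix f g =
      M.updateCol ⟨j-1, by omega⟩ (M *ᵥ fun b : Fin j => -(-1) ^ j * u b) := by
    ext a b
    rw [Matrix.submatrix_apply, Theta_entry _ _ h.2.1, hf, hg]
    by_cases hb : (b : ℕ) = j - 1
    · obtain rfl : b = ⟨j-1, hj0⟩ := Fin.ext hb
      rw [if_pos rfl, Matrix.updateCol_self]
      have ha := a.isLt
      have e1 := Th_sum (j+r) (j+1) (by omega) c h.2.1 u (fun b hb => hu3 b (by omega))
        (j + r + 1 - j + a) (by omega)
      rw [hu4 _ (by omega), Finset.sum_range_succ, hu1, Finset.sum_range] at e1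
      simp only [Matrix.mulVec, dotProduct, hM, Matrix.of_apply]
      have e2 : ∀ i : Fin j, Th (j + r) c (Pi.single (i : ℕ) 1) (j + r + 1 - j + a) *
          (-(-1) ^ j * u i) = -(-1) ^ j *
          (Th (j + r) c (Pi.single (i : ℕ) 1) (j + r + 1 - j + a) * u i) := by
        intro i; ring
      rw [Finset.sum_congr rfl (fun i _ => e2 i), ← Finset.mul_sum]
      have e3 : ((-1 : K) ^ j) * (-1) ^ j = 1 := by rw [← mul_pow]; simp
      linear_combination (-(-1) ^ j) * e1 - Th (j + r) c (Pi.single j 1) (j + r + 1 - j + a) * e3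
    · rw [if_neg hb, Matrix.updateCol_ne (fun hh => hb (congrArg Fin.val hh))]
      rfl
  rw [key, det_col, hdet, one_mul, hu2, Nat.add_sub_cancel_left]
  obtain ⟨i, rfl⟩ : ∃ i, j = i + 1 := ⟨j - 1, by omega⟩
  have e3 : ((-1 : K) ^ i) * (-1) ^ i = 1 := by rw [← mul_pow]; simp
  simp only [Nat.add_sub_cancel]
  rw [pow_succ]
  linear_combination (∑ k ∈ Finset.Icc 1 (i+1), c (r+1) k / c (r+2) (k-1)) * e3

theorem minor_two (n j : ℕ) (hj : 1 ≤ j) (hjn : j ≤ n) (c : ℕ → ℕ → K) (h : Conv n c)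
    (f g : Fin (n+1-j) → Fin (n+1)) (hf : ∀ a, (f a : ℕ) = if (a : ℕ) = 0 then j - 1 else j + a)
    (hg : ∀ a, (g a : ℕ) = a) :
    ((Theta K n c).submatrix f g).det =
      ∑ k ∈ Finset.Icc 1 j, c (j-k+1) (k-1) / c (j-k+1) k := by
  set d : ℕ → ℕ → K := fun k l => if n + 1 < k + l then 1 else (c (n+2-k-l) l)⁻¹ with hd
  have hdc : Conv n d := by
    refine ⟨?_, ?_, ?_⟩
    · intro k; simp [hd, h.1]
    · intro k l; simp only [hd]; split_ifs
      · exact one_ne_zero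
      · exact inv_ne_zero (h.2.1 _ _)
    · intro k l _ hkl; simp [hd, hkl]
  have hinv := Th_sgo n c h.2.1 d (by
    intro k l _ _ hkl
    simp only [hd]
    rw [if_neg (by omega)])
  obtain ⟨u, hu1, hu2, hu3, hu4⟩ : ∃ u : ℕ → K, u j = (-1) ^ j ∧
      u (j-1) = (-1) ^ (j-1) * ∑ k ∈ Finset.Icc 1 j, d (n-j+1) k / d (n-j+2) (k-1) ∧
      (∀ a, j < a → u a = 0) ∧ (∀ a, n - j < a → Th n d u a = 0) := by
    obtain ⟨r, rfl⟩ : ∃ r, n = j + r := ⟨n - j, by omega⟩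
    rw [Nat.add_sub_cancel_left]
    exact Th_vec r j hj d hdc
  have hS : ∑ k ∈ Finset.Icc 1 j, d (n-j+1) k / d (n-j+2) (k-1) =
      ∑ k ∈ Finset.Icc 1 j, c (j-k+1) (k-1) / c (j-k+1) k := by
    apply Finset.sum_congr rfl
    intro k hk
    have hk := Finset.mem_Icc.mp hk
    simp only [hd]
    rw [if_neg (by omega), if_neg (by omega)]
    have e1 : n + 2 - (n - j + 1) - k = j - k + 1 := by omega
    have e2 : n + 2 - (n - j + 2) - (k - 1) = j - k + 1 := by omega
    rw [e1, e2, div_eq_mul_inv, div_eq_mul_inv, inv_inv, mul_comm]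
  rw [hS] at hu2
  set S := ∑ k ∈ Finset.Icc 1 j, c (j-k+1) (k-1) / c (j-k+1) k with hSdef
  set z : ℕ → K := sgo (Th n d u) with hz
  have hz0 : ∀ b, n + 1 - j ≤ b → z b = 0 := by
    intro b hb
    rw [hz, sgo_apply, hu4 b (by omega), mul_zero]
  have hTz : ∀ a, Th n c z a = (-1) ^ a * u a := by
    intro a
    have := congrFun (LinearMap.congr_fun hinv u) a
    exact this
  have hsq : ∀ i : ℕ, ((-1 : K) ^ i) * (-1) ^ i = 1 := by
    intro i; rw [← mul_pow]; simp
  set M := (Matrix.of fun a b : Fin (n+1-j) =>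
    Th n c (Pi.single (b : ℕ) 1) (n + 1 - (n+1-j) + a)) with hM
  have hdet : M.det = 1 := Th_minor n (n+1-j) (by omega) c h
  have hn0 : 0 < n + 1 - j := by omega
  have hnj : n + 1 - (n + 1 - j) = j := by omega
  rw [det_row M _ (⟨0, by omega⟩ : Fin (n+1-j)) (fun b => z b) S, hdet, mul_one]
  · intro a ha
    have ha' : (a : ℕ) ≠ 0 := fun hh => ha (Fin.ext hh)
    funext b
    rw [Matrix.submatrix_apply, Theta_entry _ _ h.2.1, hf, hg, if_neg ha', hM, Matrix.of_apply, hnj]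
  · funext a
    have ha := a.isLt
    have e1 := Th_sum n (n+1-j) (by omega) c h.2.1 z hz0 (j + a) (by omega)
    rw [Finset.sum_range, hTz] at e1
    simp only [Matrix.mulVec, dotProduct, hM, Matrix.of_apply]
    rw [hnj, ← e1]
    by_cases h0 : (a : ℕ) = 0
    · obtain rfl : a = ⟨0, hn0⟩ := Fin.ext h0
      simp [hu1, hsq]
    · rw [hu3 _ (by omega), Pi.single_eq_of_ne (fun hh => h0 (congrArg Fin.val hh)), mul_zero]
  · funext a
    have ha := a.isLt
    have e1 := Th_sum n (n+1-j) (by omega) c h.2.1 z hz0 (f a) (f a).isLt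
    rw [Finset.sum_range, hTz] at e1
    have e2 : ((Theta K n c).submatrix f g *ᵥ fun b : Fin (n+1-j) => z b) a =
        (-1) ^ (f a : ℕ) * u (f a) := by
      rw [e1]
      simp only [Matrix.mulVec, dotProduct]
      apply Finset.sum_congr rfl
      intro b _
      rw [Matrix.submatrix_apply, Theta_entry _ _ h.2.1, hg]
    rw [e2, hf]
    by_cases h0 : (a : ℕ) = 0
    · obtain rfl : a = ⟨0, hn0⟩ := Fin.ext h0
      simp [hu2, ← mul_assoc, hsq]
    · rw [if_neg h0, hu3 _ (by omega), Pi.smul_apply,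
        Pi.single_eq_of_ne (fun hh => h0 (congrArg Fin.val hh)), mul_zero, smul_zero]

theorem order_sum (s : Finset ℕ) (hs : s.Nonempty) (f : ℕ → ℤ) :
    (∑ k ∈ s, (HahnSeries.single (f k) (1 : ℂ) : LaurentSeries ℂ)) ≠ 0 ∧
    (∑ k ∈ s, (HahnSeries.single (f k) (1 : ℂ) : LaurentSeries ℂ)).order = s.inf' hs f := by
  set F := ∑ k ∈ s, (HahnSeries.single (f k) (1 : ℂ) : LaurentSeries ℂ) with hF
  have hcoeff : ∀ m, F.coeff m = ((s.filter fun k => m = f k).card : ℂ) := by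
    intro m
    rw [hF, HahnSeries.coeff_sum, Finset.card_filter]
    push_cast
    apply Finset.sum_congr rfl
    intro k _
    rw [HahnSeries.coeff_single]
    simp
  obtain ⟨k, hk, hk2⟩ := Finset.exists_mem_eq_inf' hs f
  have hne : F.coeff (s.inf' hs f) ≠ 0 := by
    rw [hcoeff, Nat.cast_ne_zero]
    apply Finset.card_ne_zero_of_mem (a := k)
    simp [hk, hk2]
  have hF0 : F ≠ 0 := by
    intro h0; rw [h0] at hne; simp at hne
  refine ⟨hF0, le_antisymm (HahnSeries.order_le_of_coeff_ne_zero hne) ?_⟩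
  have h2 : F.coeff F.order ≠ 0 := HahnSeries.coeff_order_eq_zero.not.mpr hF0
  rw [hcoeff, Nat.cast_ne_zero, Finset.card_ne_zero] at h2
  obtain ⟨i, hi⟩ := h2
  rw [Finset.mem_filter] at hi
  rw [hi.2]
  exact Finset.inf'_le _ hi.1

theorem t_zpow (z : ℤ) : ((HahnSeries.single (1 : ℤ) (1 : ℂ) : LaurentSeries ℂ)) ^ z =
    HahnSeries.single z 1 := by
  cases z with
  | ofNat m => simp [HahnSeries.single_pow]
  | negSucc m =>
    rw [zpow_negSucc, HahnSeries.single_pow]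
    apply inv_eq_of_mul_eq_one_right
    rw [HahnSeries.single_mul_single]
    simp [Int.negSucc_eq]

end Helpers

/-- Substituting `c_{k,l} = t^{x_{k,l}}` (Laurent series in `t`) in `Θ(c)`, for every
`1 ≤ j ≤ n` the two generalized minors are nonzero and their orders of vanishing at `t = 0`
(lowest exponents) are `min_{1≤k≤j}(x_{n−j+1,k} − x_{n−j+2,k−1})` and
`min_{1≤k≤j}(x_{j−k+1,k−1} − x_{j−k+1,k})` respectively: these are the
ultra-discretizations `UD(Δ_{w₀Λ_j,s_jΛ_j}∘Θ)` and `UD(Δ_{w₀s_jΛ_j,Λ_j}∘Θ)`. -/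
theorem stmt6 (n j : ℕ) (hn : 1 ≤ n) (hj : 1 ≤ j) (hjn : j ≤ n)
    (x : ℕ → ℕ → ℤ) (hx0 : ∀ m, x m 0 = 0) (hxout : ∀ k l, n + 1 < k + l → x k l = 0)
    (c : ℕ → ℕ → LaurentSeries ℂ)
    (hc : ∀ k l, c k l = (HahnSeries.single (1 : ℤ) (1 : ℂ)) ^ (x k l)) :
    (((Theta (LaurentSeries ℂ) n c).submatrix
        (fun a : Fin j => (⟨n + 1 - j + (a : ℕ), by have := a.isLt; omega⟩ : Fin (n+1)))
        (fun a : Fin j => if (a : ℕ) = j - 1 then (⟨j, by omega⟩ : Fin (n+1))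
          else (⟨(a : ℕ), by have := a.isLt; omega⟩ : Fin (n+1)))).det ≠ 0 ∧
      ((Theta (LaurentSeries ℂ) n c).submatrix
        (fun a : Fin j => (⟨n + 1 - j + (a : ℕ), by have := a.isLt; omega⟩ : Fin (n+1)))
        (fun a : Fin j => if (a : ℕ) = j - 1 then (⟨j, by omega⟩ : Fin (n+1))
          else (⟨(a : ℕ), by have := a.isLt; omega⟩ : Fin (n+1)))).det.order
        = Finset.inf' (Finset.Icc 1 j) (Finset.nonempty_Icc.mpr hj)
            (fun k => x (n - j + 1) k - x (n - j + 2) (k - 1))) ∧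
    (((Theta (LaurentSeries ℂ) n c).submatrix
        (fun a : Fin (n + 1 - j) => if (a : ℕ) = 0 then (⟨j - 1, by omega⟩ : Fin (n+1))
          else (⟨j + (a : ℕ), by have := a.isLt; omega⟩ : Fin (n+1)))
        (fun a : Fin (n + 1 - j) => (⟨(a : ℕ), by have := a.isLt; omega⟩ : Fin (n+1)))).det ≠ 0 ∧
      ((Theta (LaurentSeries ℂ) n c).submatrix
        (fun a : Fin (n + 1 - j) => if (a : ℕ) = 0 then (⟨j - 1, by omega⟩ : Fin (n+1))
          else (⟨j + (a : ℕ), by have := a.isLt; omega⟩ : Fin (n+1)))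
        (fun a : Fin (n + 1 - j) => (⟨(a : ℕ), by have := a.isLt; omega⟩ : Fin (n+1)))).det.order
        = Finset.inf' (Finset.Icc 1 j) (Finset.nonempty_Icc.mpr hj)
            (fun k => x (j - k + 1) (k - 1) - x (j - k + 1) k)) := by
  have ht : (HahnSeries.single (1 : ℤ) (1 : ℂ) : LaurentSeries ℂ) ≠ 0 := by simp
  have hconv : Conv n c := by
    refine ⟨?_, ?_, ?_⟩
    · intro k; rw [hc, hx0, zpow_zero]
    · intro k l; rw [hc]; exact zpow_ne_zero _ ht
    · intro k l _ hkl; rw [hc, hxout k l hkl, zpow_zero]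
  have hdiv : ∀ k l k' l', c k l / c k' l' =
      HahnSeries.single (x k l - x k' l') (1 : ℂ) := by
    intro k l k' l'
    rw [hc, hc, ← zpow_sub₀ ht, t_zpow]
  refine ⟨?_, ?_⟩
  · rw [minor_one n j hj hjn c hconv _ _ (fun a => rfl) (fun a => by split_ifs <;> rfl)]
    simp only [hdiv]
    exact order_sum _ _ _
  · rw [minor_two n j hj hjn c hconv _ _ (fun a => by split_ifs <;> rfl) (fun a => rfl)]
    simp only [hdiv]
    exact order_sum _ _ _
end

section
/- Let n ≥ 1 and λ = Σ_{i=1}^n λ_iΛ_i with all λ_i ∈ ℤ_{≥0}. Let B_{f_B}(λ) ⊆ ℤ^{n(n+1)/2} be the set of integer families (x_{k,l})_{k+l≤n+1} such that for every 1 ≤ j ≤ n, min_{1≤k≤j}( x_{n−j+1,k} − x_{n−j+2,k−1} ) ≥ 0 and λ_j + min_{1≤k≤j}( x_{j−k+1,k−1} − x_{j−k+1,k} ) ≥ 0 (conventions x_{m,0} = 0 and x_{k,l} = 0 for k+l > n+1). Then the map sending x ∈ Σ_ι[λ] to the family (x_{j;i})_{i+j ≤ n+1}, where x_{j;i} :=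 x_{(j−1)n+i}, is a bijection from the polyhedral realization Σ_ι[λ] onto B_{f_B}(λ). (This is the underlying set identification of the isomorphism of crystals B_{f_B,Θ⁻_{𝐢₀}}[λ] ≅ Σ_{ι₀}[λ] of Theorem 5.2.) -/
/-- The type `A_n` Cartan matrix (1-based indices). -/
def cartanA (i j : ℕ) : ℤ := if i = j then 2 else if i + 1 = j ∨ j + 1 = i then -1 else 0

/-- The periodic sequence `ι = (i_k)_{k≥1}`, `i_k = ((k−1) mod n) + 1`. -/
def iota (n k : ℕ) : ℕ := (k - 1) % n + 1

/-- Evaluation of an affine-linear form `(c, (φ_k)_k)` at `x ∈ ℤ^∞`: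
`φ(x) = c + Σ_k φ_k x_k`. -/
noncomputable def evalForm (φ : ℚ × (ℕ → ℚ)) (x : ℕ → ℤ) : ℚ :=
  φ.1 + ∑ᶠ k, φ.2 k * (x k : ℚ)

/-- Coefficients of `β_k^{(+)}(x) = x_k + Σ_{k<j<k⁺} a_{i_k,i_j} x_j + x_{k⁺}`; for the
periodic sequence `ι` one has `k⁺ = k + n`. -/
def bplus (n k : ℕ) : ℕ → ℚ := fun j =>
  (if j = k then 1 else 0)
  + (if k < j ∧ j < k + n then (cartanA (iota n k) (iota n j) : ℚ) else 0)
  + (if j = k + n then 1 else 0)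

/-- The affine-linear form `β_k^{(−)}`; for the periodic sequence `ι` one has `k⁻ = k − n`
(`= 0` when `k ≤ n`, in which case the constant term `−λ_{i_k}` appears). -/
def bminus (n : ℕ) (lam : ℕ → ℕ) (k : ℕ) : ℚ × (ℕ → ℚ) :=
  if n < k then
    (0, fun j =>
      (if j = k - n then 1 else 0)
      + (if k - n < j ∧ j < k then (cartanA (iota n k) (iota n j) : ℚ) else 0)
      + (if j = k then 1 else 0))
  else
    (-(lam (iota n k) : ℚ), fun j =>
      (if 1 ≤ j ∧ j < k then (cartanA (iota n k) (iota n j) : ℚ) else 0)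
      + (if j = k then 1 else 0))

/-- The operator `Ŝ_k`: `Ŝ_kφ = φ − φ_k β_k^{(+)}` if `φ_k > 0`, and
`Ŝ_kφ = φ − φ_k β_k^{(−)}` if `φ_k ≤ 0`. -/
def Shat (n : ℕ) (lam : ℕ → ℕ) (k : ℕ) (φ : ℚ × (ℕ → ℚ)) : ℚ × (ℕ → ℚ) :=
  if 0 < φ.2 k then φ - φ.2 k • ((0 : ℚ), bplus n k) else φ - φ.2 k • bminus n lam k

/-- The form `λ^{(i)}(x) = λ_i − Σ_{1≤j<ι^{(i)}} a_{i,i_j} x_j − x_{ι^{(i)}}`; for the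
periodic sequence `ι` one has `ι^{(i)} = i`. -/
def lamform (n : ℕ) (lam : ℕ → ℕ) (i : ℕ) : ℚ × (ℕ → ℚ) :=
  ((lam i : ℚ), fun j =>
    -(if 1 ≤ j ∧ j < i then (cartanA i (iota n j) : ℚ) else 0) - (if j = i then 1 else 0))

/-- `Ξ_ι[λ]`: the smallest set of affine-linear forms containing the coordinate forms `x_j`
(`j ≥ 1`) and the forms `λ^{(i)}` (`1 ≤ i ≤ n`) and closed under all `Ŝ_k` (`k ≥ 1`). -/
inductive XiLam (n : ℕ) (lam : ℕ → ℕ) : (ℚ × (ℕ → ℚ)) → Prop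
  | coord (j : ℕ) (hj : 1 ≤ j) : XiLam n lam (0, fun k => if k = j then 1 else 0)
  | lamf (i : ℕ) (hi : 1 ≤ i) (hi' : i ≤ n) : XiLam n lam (lamform n lam i)
  | shat (k : ℕ) (hk : 1 ≤ k) (φ : ℚ × (ℕ → ℚ)) (h : XiLam n lam φ) :
      XiLam n lam (Shat n lam k φ)


/-- The polyhedral realization `Σ_ι[λ] ⊆ ℤ^∞` (elements of `ℤ^∞` are encoded as finitely
supported functions `ℕ → ℤ` vanishing at the unused index `0`). -/
def SigmaSet (n : ℕ) (lam : ℕ → ℕ) : Set (ℕ → ℤ) :=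
  {x | x 0 = 0 ∧ (Function.support x).Finite ∧
    ∀ φ : ℚ × (ℕ → ℚ), XiLam n lam φ → 0 ≤ evalForm φ x}

/-- `B_{f_B}(λ)`: integer families `(x_{k,l})_{k+l≤n+1}` (encoded as functions `ℕ → ℕ → ℤ`
vanishing outside `{(k,l) : k,l ≥ 1, k+l ≤ n+1}`) such that for every `1 ≤ j ≤ n`,
`min_{1≤k≤j}(x_{n−j+1,k} − x_{n−j+2,k−1}) ≥ 0` and
`λ_j + min_{1≤k≤j}(x_{j−k+1,k−1} − x_{j−k+1,k}) ≥ 0` (with `x_{m,0} = 0`). -/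
def BfB (n : ℕ) (lam : ℕ → ℕ) : Set (ℕ → ℕ → ℤ) :=
  {y | (∀ k l, (k = 0 ∨ l = 0 ∨ n + 1 < k + l) → y k l = 0) ∧
    ∀ j, ∀ hj : 1 ≤ j, j ≤ n →
      0 ≤ Finset.inf' (Finset.Icc 1 j) (Finset.nonempty_Icc.mpr hj)
            (fun k => y (n - j + 1) k - y (n - j + 2) (k - 1)) ∧
      0 ≤ (lam j : ℤ) + Finset.inf' (Finset.Icc 1 j) (Finset.nonempty_Icc.mpr hj)
            (fun k => y (j - k + 1) (k - 1) - y (j - k + 1) k)}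

namespace PR

/-- coordinate form `x_{l;m}` (zero outside the strip) -/
def D (n l m : ℕ) : ℕ → ℚ := fun k =>
  if 1 ≤ l ∧ 1 ≤ m ∧ m ≤ n ∧ k = (l - 1) * n + m then 1 else 0

def Box (n l m : ℕ) : ℕ → ℚ := D n l m - D n (l + 1) (m - 1)

/-- coordinates of the strip -/
def fX (n : ℕ) (x : ℕ → ℤ) (l m : ℕ) : ℤ :=
  if 1 ≤ l ∧ 1 ≤ m ∧ m ≤ n then x ((l - 1) * n + m) else 0

theorem idx_inj {n l m l' m' : ℕ} (hl : 1 ≤ l) (hl' : 1 ≤ l') (hm : 1 ≤ m) (hm' : 1 ≤ m')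
    (hmn : m ≤ n) (hmn' : m' ≤ n) (h : (l - 1) * n + m = (l' - 1) * n + m') :
    l = l' ∧ m = m' := by
  obtain ⟨a, rfl⟩ := Nat.exists_eq_add_of_le' hl
  obtain ⟨b, rfl⟩ := Nat.exists_eq_add_of_le' hl'
  simp only [Nat.add_sub_cancel] at h
  rcases lt_trichotomy a b with hab | hab | hab
  · exfalso
    have : (a + 1) * n ≤ b * n := Nat.mul_le_mul_right _ hab
    rw [Nat.add_mul] at this; omega
  · subst hab; omega
  · exfalso
    have : (b + 1) * n ≤ a * n := Nat.mul_le_mul_right _ hab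
    rw [Nat.add_mul] at this; omega

theorem exists_idx {n k : ℕ} (hn : 1 ≤ n) (hk : 1 ≤ k) :
    ∃ l m, 1 ≤ l ∧ 1 ≤ m ∧ m ≤ n ∧ k = (l - 1) * n + m := by
  refine ⟨(k - 1) / n + 1, (k - 1) % n + 1, Nat.le_add_left _ _, Nat.le_add_left _ _, ?_, ?_⟩
  · have := Nat.mod_lt (k - 1) (show n > 0 by omega); omega
  · have := Nat.div_add_mod (k - 1) n
    rw [Nat.add_sub_cancel, Nat.mul_comm]; omega

theorem iota_idx {n l m : ℕ} (hm : 1 ≤ m) (hmn : m ≤ n) :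
    iota n ((l - 1) * n + m) = m := by
  unfold iota
  have : (l - 1) * n + m - 1 = (m - 1) + (l - 1) * n := by omega
  rw [this, Nat.add_mul_mod_self_right, Nat.mod_eq_of_lt (by omega)]; omega

theorem D_idx {n l m l' m' : ℕ} (hl : 1 ≤ l) (hm : 1 ≤ m) (hmn : m ≤ n) :
    D n l' m' ((l - 1) * n + m) = if l' = l ∧ m' = m then 1 else 0 := by
  unfold D
  congr 1
  apply propext
  constructor
  · rintro ⟨h1, h2, h3, h4⟩
    have := idx_inj hl h1 hm h2 hmn h3 h4
    omega
  · rintro ⟨rfl, rfl⟩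
    exact ⟨hl, hm, hmn, rfl⟩

theorem D_zero (n l : ℕ) : D n l 0 = 0 := by
  funext k; simp [D]

theorem bplus_idx {n l m : ℕ} (hl : 1 ≤ l) (hm : 1 ≤ m) (hmn : m ≤ n) :
    bplus n ((l - 1) * n + m) = Box n l m - Box n l (m + 1) := by
  funext j
  have e : (l + 1 - 1) * n = (l - 1) * n + n := by
    obtain ⟨a, rfl⟩ := Nat.exists_eq_add_of_le' hl
    simp [Nat.add_mul]
  simp only [bplus, Box, Pi.sub_apply, D, Nat.add_sub_cancel]
  have e0 := e
  rw [Nat.add_sub_cancel] at e0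
  rw [e0]
  rw [iota_idx hm hmn]
  by_cases hj : (l - 1) * n + m < j ∧ j < (l - 1) * n + m + n
  · obtain ⟨d, rfl⟩ : ∃ d, j = (l - 1) * n + m + d := ⟨j - ((l - 1) * n + m), by omega⟩
    by_cases hd : m + d ≤ n
    · have hi : iota n ((l - 1) * n + m + d) = m + d := by
        rw [Nat.add_assoc]; exact iota_idx (by omega) hd
      rw [hi]; unfold cartanA
      generalize (l - 1) * n = A at *
      split_ifs <;> first | omega | norm_num
    · have hi : iota n ((l - 1) * n + m + d) = m + d - n := by
        have : (l - 1) * n + m + d = (l + 1 - 1) * n + (m + d - n) := by omega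
        rw [this]; exact iota_idx (by omega) (by omega)
      rw [hi]; unfold cartanA
      generalize (l - 1) * n = A at *
      split_ifs <;> first | omega | norm_num
  · rw [if_neg hj]
    generalize (l - 1) * n = A at *
    split_ifs <;> first | omega | norm_num

theorem bminus_idx {n l m : ℕ} (lam : ℕ → ℕ) (hl : 1 ≤ l) (hm : 1 ≤ m) (hmn : m ≤ n) :
    bminus n lam ((l + 1 - 1) * n + m) = (0, Box n l m - Box n l (m + 1)) := by
  rw [← bplus_idx hl hm hmn]
  have e : (l + 1 - 1) * n = (l - 1) * n + n := by
    obtain ⟨a, rfl⟩ := Nat.exists_eq_add_of_le' hl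
    simp [Nat.add_mul]
  have e2 : (l + 1 - 1) * n + m - n = (l - 1) * n + m := by omega
  have e3 : (l - 1) * n + m + n = (l + 1 - 1) * n + m := by omega
  unfold bminus bplus
  rw [if_pos (by omega), iota_idx hm hmn, iota_idx hm hmn, e2, e3]

theorem bminus_one {n m : ℕ} (lam : ℕ → ℕ) (hm : 1 ≤ m) (hmn : m ≤ n) :
    bminus n lam ((1 - 1) * n + m) = (-(lam m : ℚ), D n 1 m - D n 1 (m - 1)) := by
  unfold bminus
  rw [if_neg (by simp; omega), iota_idx hm hmn]
  congr 1
  funext j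
  simp only [D, Pi.sub_apply, cartanA, Nat.sub_self, Nat.zero_mul, Nat.zero_add]
  by_cases hj : 1 ≤ j ∧ j < m
  · have : iota n j = j := by
      have := @iota_idx n 1 j hj.1 (by omega)
      simpa using this
    rw [this]
    split_ifs <;> first | omega | norm_num
  · rw [if_neg hj]
    split_ifs <;> first | omega | norm_num

theorem lamform_eq {n m : ℕ} (lam : ℕ → ℕ) (hm : 1 ≤ m) (hmn : m ≤ n) :
    lamform n lam m = ((lam m : ℚ), D n 1 (m - 1) - D n 1 m) := by
  unfold lamform
  congr 1
  funext j
  simp only [D, Pi.sub_apply, cartanA, Nat.sub_self, Nat.zero_mul, Nat.zero_add]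
  by_cases hj : 1 ≤ j ∧ j < m
  · have : iota n j = j := by
      have := @iota_idx n 1 j hj.1 (by omega)
      simpa using this
    rw [this]
    split_ifs <;> first | omega | norm_num
  · rw [if_neg hj]
    split_ifs <;> first | omega | norm_num

theorem coord_eq {n l m : ℕ} (hl : 1 ≤ l) (hm : 1 ≤ m) (hmn : m ≤ n) :
    (fun k => if k = (l - 1) * n + m then (1 : ℚ) else 0) = D n l m := by
  funext k; simp [D, hl, hm, hmn]

theorem idx_pos {n l m : ℕ} (hm : 1 ≤ m) : 1 ≤ (l - 1) * n + m := by omega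

/-- evaluation as a linear map -/
noncomputable def E (x : ℕ → ℤ) (hx : (Function.support x).Finite) : (ℕ → ℚ) →ₗ[ℚ] ℚ :=
  ∑ k ∈ hx.toFinset, (x k : ℚ) • LinearMap.proj k

theorem evalForm_eq (x : ℕ → ℤ) (hx : (Function.support x).Finite) (φ : ℚ × (ℕ → ℚ)) :
    evalForm φ x = φ.1 + E x hx φ.2 := by
  unfold evalForm E
  congr 1
  rw [finsum_eq_sum_of_support_subset (s := hx.toFinset)]
  · simp [LinearMap.sum_apply, mul_comm]
  · intro k hk
    simp only [Function.mem_support, Set.Finite.coe_toFinset] at *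
    intro h; apply hk; simp [h]

theorem E_D (n : ℕ) (x : ℕ → ℤ) (hx : (Function.support x).Finite) (l m : ℕ) :
    E x hx (D n l m) = (fX n x l m : ℚ) := by
  unfold E fX D
  simp only [LinearMap.sum_apply, LinearMap.smul_apply, LinearMap.proj_apply, smul_eq_mul]
  by_cases h : 1 ≤ l ∧ 1 ≤ m ∧ m ≤ n
  · simp only [h, true_and, if_true, and_self, mul_ite, mul_one, mul_zero, Finset.sum_ite_eq']
    split_ifs with h2
    · rfl
    · simp at h2; simp [h2]
  · rw [if_neg h]
    simp only [Int.cast_zero]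
    apply Finset.sum_eq_zero
    intro k _
    rw [if_neg (fun h' => h ⟨h'.1, h'.2.1, h'.2.2.1⟩), mul_zero]

theorem Box_idx {n l m l' m' : ℕ} (hl : 1 ≤ l) (hm : 1 ≤ m) (hmn : m ≤ n) :
    Box n l' m' ((l - 1) * n + m) =
      (if l' = l ∧ m' = m then 1 else 0) - (if l' + 1 = l ∧ m' = m + 1 then 1 else 0) := by
  simp only [Box, Pi.sub_apply, D_idx hl hm hmn]
  congr 2
  apply propext
  omega

theorem Box_zero (n l : ℕ) : Box n l 0 = 0 := by
  simp [Box, D_zero]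

theorem Box_mem {n : ℕ} (hn : 1 ≤ n) (lam : ℕ → ℕ) {l : ℕ} (hl : 1 ≤ l) (m : ℕ) (hm : m ≤ n) :
    XiLam n lam (0, Box n l (m + 1)) := by
  induction m with
  | zero =>
    have := XiLam.coord (n := n) (lam := lam) ((l - 1) * n + 1) (by omega)
    rw [coord_eq hl le_rfl hn] at this
    simpa [Box, D_zero] using this
  | succ m ih =>
    have := XiLam.shat ((l - 1) * n + (m + 1)) (by omega) _ (ih (by omega))
    unfold Shat at this
    simp only [Box_idx hl (show 1 ≤ m + 1 by omega) hm, bplus_idx hl (show 1 ≤ m + 1 by omega) hm] at this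
    simpa using this

theorem L_step {n : ℕ} (lam : ℕ → ℕ) {i k : ℕ} (hk : 1 ≤ k) (hki : k < i) (hi : i ≤ n) :
    Shat n lam ((k - 1) * n + (i - k)) ((lam i : ℚ), D n k (i - k) - D n k (i - k + 1)) =
      ((lam i : ℚ), D n (k + 1) (i - (k + 1)) - D n (k + 1) (i - (k + 1) + 1)) := by
  unfold Shat
  simp only [Pi.sub_apply, D_idx hk (show 1 ≤ i - k by omega) (show i - k ≤ n by omega),
    bplus_idx hk (show 1 ≤ i - k by omega) (show i - k ≤ n by omega)]
  have e1 : i - (k + 1) = i - k - 1 := by omega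
  have e2 : i - (k + 1) + 1 = i - k := by omega
  rw [e2, e1]
  ext j
  · simp
  · simp [Box]; ring

theorem L_mem {n : ℕ} (lam : ℕ → ℕ) {i : ℕ} (k : ℕ) (hki : k + 1 ≤ i) (hi : i ≤ n) :
    XiLam n lam ((lam i : ℚ), D n (k + 1) (i - (k + 1)) - D n (k + 1) (i - (k + 1) + 1)) := by
  induction k with
  | zero =>
    have := XiLam.lamf (n := n) (lam := lam) i hki hi
    rw [lamform_eq lam hki hi] at this
    simpa [Nat.sub_add_cancel hki] using this
  | succ k ih =>
    have := XiLam.shat _ (idx_pos (n := n) (l := k + 1) (show 1 ≤ i - (k + 1) by omega)) _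
      (ih (by omega))
    rwa [L_step lam (by omega) (by omega) hi] at this

/-- the description of the generated forms -/
def Good (n : ℕ) (lam : ℕ → ℕ) (φ : ℚ × (ℕ → ℚ)) : Prop :=
  φ = 0 ∨
  (∃ i k, 1 ≤ k ∧ k ≤ i ∧ i ≤ n ∧ φ = ((lam i : ℚ), D n k (i - k) - D n k (i - k + 1))) ∨
  (∃ (N : ℕ) (T : ℕ → ℕ), T 0 = 0 ∧ (∀ l, T l ≤ n + 1) ∧ (∀ l, N ≤ l → T l = 0) ∧
    (∀ l, T l ≠ 0 → T (l + 1) ≠ 0 → T (l + 1) < T l) ∧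
    φ = (0, ∑ l ∈ Finset.range N, Box n l (T l)))

theorem good_coord {n : ℕ} (lam : ℕ → ℕ) {l m : ℕ} (hl : 1 ≤ l) (hmn : m ≤ n) :
    Good n lam (0, D n l m) := by
  refine Or.inr (Or.inr ⟨l + m, fun k => if l ≤ k then m + l - k else 0, ?_, ?_, ?_, ?_, ?_⟩)
  · dsimp only; rw [if_neg (by omega)]
  · intro k; dsimp only; split_ifs <;> omega
  · intro k; dsimp only; split_ifs <;> omega
  · intro k; dsimp only; split_ifs <;> omega
  · congr 1
    have key : ∀ k ∈ Finset.range (l + m), Box n k (if l ≤ k then m + l - k else 0) =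
        (fun k => if l ≤ k then D n k (m + l - k) else D n l m) k -
        (fun k => if l ≤ k then D n k (m + l - k) else D n l m) (k + 1) := by
      intro k _
      dsimp only
      by_cases h : l ≤ k
      · rw [if_pos h, if_pos h, if_pos (by omega)]
        unfold Box
        rw [Nat.sub_sub]
      · rw [if_neg h, if_neg h, Box_zero]
        by_cases h' : l ≤ k + 1
        · have : k + 1 = l := by omega
          rw [if_pos h', this, Nat.add_sub_cancel, sub_self]
        · rw [if_neg h', sub_self]
    rw [Finset.sum_congr rfl key, Finset.sum_range_sub']
    have : m + l - (l + m) = 0 := by omega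
    simp [this, D_zero, show ¬ (l = 0) by omega]

theorem sum_move {n N : ℕ} {T : ℕ → ℕ} {l : ℕ} (hl : l < N) (a : ℕ) :
    ∑ k ∈ Finset.range N, Box n k (Function.update T l a k) =
      ∑ k ∈ Finset.range N, Box n k (T k) - (Box n l (T l) - Box n l a) := by
  rw [← Finset.sum_erase_add _ _ (Finset.mem_range.mpr hl),
    ← Finset.sum_erase_add (Finset.range N) (fun k => Box n k (T k)) (Finset.mem_range.mpr hl)]
  have : ∑ k ∈ (Finset.range N).erase l, Box n k (Function.update T l a k) =
      ∑ k ∈ (Finset.range N).erase l, Box n k (T k) := by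
    apply Finset.sum_congr rfl
    intro k hk
    rw [Function.update_of_ne (Finset.ne_of_mem_erase hk)]
  rw [this, Function.update_self]
  abel

theorem coeff {n N : ℕ} {T : ℕ → ℕ} (h0 : T 0 = 0) (hN : ∀ l, N ≤ l → T l = 0)
    {l m : ℕ} (hl : 1 ≤ l) (hm : 1 ≤ m) (hmn : m ≤ n) :
    (∑ k ∈ Finset.range N, Box n k (T k)) ((l - 1) * n + m) =
      (if T l = m then 1 else 0) - (if T (l - 1) = m + 1 then 1 else 0) := by
  rw [Finset.sum_apply]
  simp only [Box_idx hl hm hmn, Finset.sum_sub_distrib]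
  congr 1
  · rw [Finset.sum_eq_single l]
    · simp
    · intro b _ hb; simp [hb]
    · intro h
      have := hN l (by simpa using h)
      rw [if_neg]; omega
  · rw [Finset.sum_eq_single (l - 1)]
    · simp [Nat.sub_add_cancel hl]
    · intro b _ hb; rw [if_neg]; omega
    · intro h
      have := hN (l - 1) (by simpa using h)
      rw [if_neg]; omega

theorem good_shat {n : ℕ} (lam : ℕ → ℕ) {l m : ℕ} (hl : 1 ≤ l) (hm : 1 ≤ m) (hmn : m ≤ n)
    {φ : ℚ × (ℕ → ℚ)} (h : Good n lam φ) : Good n lam (Shat n lam ((l - 1) * n + m) φ) := by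
  have triv : φ.2 ((l - 1) * n + m) = 0 → Good n lam (Shat n lam ((l - 1) * n + m) φ) := by
    intro h0
    unfold Shat
    simpa [h0] using h
  rcases h with h | ⟨i, k, hk, hki, hi, rfl⟩ | ⟨N, T, h0, hn1, hN, hT, rfl⟩
  · exact triv (by simp [h])
  · by_cases hA : k = l ∧ i - k = m
    · obtain ⟨rfl, rfl⟩ := hA
      rw [L_step lam hk (by omega) hi]
      exact Or.inr (Or.inl ⟨i, k + 1, by omega, by omega, hi, rfl⟩)
    by_cases hB : k = l ∧ i - k + 1 = m
    · obtain ⟨rfl, rfl⟩ := hB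
      have hc : (D n k (i - k) - D n k (i - k + 1)) ((k - 1) * n + (i - k + 1)) = -1 := by
        simp [D_idx hk hm hmn]
      unfold Shat
      simp only [hc]
      rw [if_neg (by norm_num)]
      rcases Nat.lt_or_ge 1 k with h1 | h1
      · obtain ⟨k, rfl⟩ := Nat.exists_eq_add_of_le' hk
        rw [bminus_idx lam (by omega) hm hmn]
        refine Or.inr (Or.inl ⟨i, k, by omega, by omega, hi, ?_⟩)
        have e1 : i - (k + 1) + 1 = i - k := by omega
        rw [e1]
        have e2 : i - (k + 1) = i - k - 1 := by omega
        rw [e2]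
        ext j
        · simp
        · simp [Box]; ring
      · have : k = 1 := by omega
        subst this
        rw [bminus_one lam hm hmn]
        left
        have e1 : i - 1 + 1 = i := by omega
        rw [e1]
        ext j
        · simp
        · simp
    · apply triv
      simp only [Pi.sub_apply, D_idx hl hm hmn]
      rw [if_neg hA, if_neg hB, sub_self]
  · have hc := coeff (n := n) h0 hN hl hm hmn
    by_cases hA : T l = m
    · by_cases hB : T (l - 1) = m + 1
      · apply triv
        simp only [hc, if_pos hA, if_pos hB, sub_self]
      · have hlN : l < N := by
          by_contra h; have := hN l (by omega); omega
        unfold Shat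
        simp only [hc, if_pos hA, if_neg hB]
        rw [if_pos (by norm_num), bplus_idx hl hm hmn]
        refine Or.inr (Or.inr ⟨N, Function.update T l (m + 1), ?_, ?_, ?_, ?_, ?_⟩)
        · rw [Function.update_of_ne (by omega)]; exact h0
        · intro k; by_cases hk : k = l
          · subst hk; simp; omega
          · rw [Function.update_of_ne hk]; exact hn1 k
        · intro k hk; rw [Function.update_of_ne (by omega)]; exact hN k hk
        · intro k
          have h1 := hT k
          by_cases hk : k = l
          · subst hk
            rw [Function.update_self, Function.update_of_ne (by omega)]
            omega
          · by_cases hk' : k + 1 = l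
            · subst hk'
              rw [Nat.add_sub_cancel] at hB
              rw [Function.update_self, Function.update_of_ne (by omega)]
              omega
            · rw [Function.update_of_ne hk, Function.update_of_ne hk']
              exact h1
        · rw [sum_move hlN, hA]
          ext j <;> simp
    · by_cases hB : T (l - 1) = m + 1
      · obtain ⟨l, rfl⟩ := Nat.exists_eq_add_of_le' hl
        rw [Nat.add_sub_cancel] at hB
        have hl1 : 1 ≤ l := by
          rcases Nat.eq_zero_or_pos l with h | h
          · subst h; omega
          · exact h
        have hlN : l < N := by
          by_contra h; have := hN l (by omega); omega
        unfold Shat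
        rw [Nat.add_sub_cancel] at hc
        rw [Nat.add_sub_cancel]
        simp only [hc, if_neg hA, if_pos hB]
        rw [if_neg (by norm_num)]
        have hbm := bminus_idx lam hl1 hm hmn
        rw [Nat.add_sub_cancel] at hbm
        rw [hbm]
        refine Or.inr (Or.inr ⟨N, Function.update T l m, ?_, ?_, ?_, ?_, ?_⟩)
        · rw [Function.update_of_ne (by omega)]; exact h0
        · intro k; by_cases hk : k = l
          · subst hk; simp; omega
          · rw [Function.update_of_ne hk]; exact hn1 k
        · intro k hk; rw [Function.update_of_ne (by omega)]; exact hN k hk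
        · intro k
          have h1 := hT k
          by_cases hk : k = l
          · subst hk
            rw [Function.update_self, Function.update_of_ne (by omega)]
            omega
          · by_cases hk' : k + 1 = l
            · subst hk'
              rw [Function.update_self, Function.update_of_ne (by omega)]
              omega
            · rw [Function.update_of_ne hk, Function.update_of_ne hk']
              exact h1
        · rw [sum_move hlN, hB]
          ext j
          · simp
          · simp
      · apply triv
        simp only [hc, if_neg hA, if_neg hB, sub_self]

theorem good_of_mem {n : ℕ} (hn : 1 ≤ n) (lam : ℕ → ℕ) {φ : ℚ × (ℕ → ℚ)} (h : XiLam n lam φ) :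
    Good n lam φ := by
  induction h with
  | coord j hj =>
    obtain ⟨l, m, hl, hm, hmn, rfl⟩ := exists_idx hn hj
    rw [coord_eq hl hm hmn]
    exact good_coord lam hl hmn
  | lamf i hi hi' =>
    rw [lamform_eq lam hi hi']
    refine Or.inr (Or.inl ⟨i, 1, le_rfl, hi, hi', ?_⟩)
    rw [Nat.sub_add_cancel hi]
  | shat k hk φ _ ih =>
    obtain ⟨l, m, hl, hm, hmn, rfl⟩ := exists_idx hn hk
    exact good_shat lam hl hm hmn ih

theorem sigma_iff {n : ℕ} (hn : 1 ≤ n) (lam : ℕ → ℕ) (x : ℕ → ℤ) (h0 : x 0 = 0)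
    (hx : (Function.support x).Finite) :
    x ∈ SigmaSet n lam ↔
      (∀ l m, 1 ≤ l → m ≤ n → fX n x (l + 1) m ≤ fX n x l (m + 1)) ∧
      (∀ i k, 1 ≤ k → k ≤ i → i ≤ n →
        0 ≤ (lam i : ℤ) + (fX n x k (i - k) - fX n x k (i - k + 1))) := by
  constructor
  · rintro ⟨-, -, h⟩
    constructor
    · intro l m hl hm
      have := h _ (Box_mem hn lam hl m hm)
      rw [evalForm_eq x hx] at this
      simp only [Box, map_sub, E_D, Nat.add_sub_cancel, zero_add, sub_nonneg] at this
      exact_mod_cast this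
    · intro i k hk hki hi
      obtain ⟨k, rfl⟩ := Nat.exists_eq_add_of_le' hk
      have := h _ (L_mem lam k hki hi)
      rw [evalForm_eq x hx] at this
      simp only [map_sub, E_D] at this
      exact_mod_cast this
  · rintro ⟨h1, h2⟩
    refine ⟨h0, hx, fun φ hφ => ?_⟩
    rw [evalForm_eq x hx]
    rcases good_of_mem hn lam hφ with rfl | ⟨i, k, hk, hki, hi, rfl⟩ | ⟨N, T, hT0, hn1, hN, hT, rfl⟩
    · simp
    · simp only [map_sub, E_D]
      exact_mod_cast h2 i k hk hki hi
    · simp only [map_sum, zero_add]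
      apply Finset.sum_nonneg
      intro l _
      rcases Nat.eq_zero_or_pos (T l) with h | h
      · rw [h, Box_zero, map_zero]
      · have hl : 1 ≤ l := by
          rcases Nat.eq_zero_or_pos l with h' | h'
          · subst h'; omega
          · exact h'
        have := h1 l (T l - 1) hl (by have := hn1 l; omega)
        rw [Nat.sub_add_cancel h] at this
        simp only [Box, map_sub, E_D, sub_nonneg]
        exact_mod_cast this

theorem fX_nonneg {n : ℕ} (lam : ℕ → ℕ) {x : ℕ → ℤ} (h : x ∈ SigmaSet n lam) (l m : ℕ) :
    0 ≤ fX n x l m := by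
  obtain ⟨-, hx, h⟩ := h
  by_cases hv : 1 ≤ l ∧ 1 ≤ m ∧ m ≤ n
  · have := h _ (XiLam.coord ((l - 1) * n + m) (by omega))
    rw [evalForm_eq x hx, coord_eq hv.1 hv.2.1 hv.2.2, E_D] at this
    simp only [zero_add] at this
    exact_mod_cast this
  · unfold fX; rw [if_neg hv]

theorem fX_vanish {n : ℕ} (hn : 1 ≤ n) (lam : ℕ → ℕ) {x : ℕ → ℤ} (h : x ∈ SigmaSet n lam) (d : ℕ) :
    ∀ l m, m + d = n + 1 → n + 1 < l + m → fX n x l m = 0 := by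
  have h1 := ((sigma_iff hn lam x h.1 h.2.1).1 h).1
  induction d with
  | zero =>
    intro l m hm _
    unfold fX; rw [if_neg (by omega)]
  | succ d ih =>
    intro l m hm hlm
    obtain ⟨l, rfl⟩ : ∃ l', l = l' + 1 := ⟨l - 1, by omega⟩
    have a := h1 l m (by omega) (by omega)
    rw [ih l (m + 1) (by omega) (by omega)] at a
    exact le_antisymm a (fX_nonneg lam h _ _)

theorem map_eq {n : ℕ} (hn : 1 ≤ n) (lam : ℕ → ℕ) {x : ℕ → ℤ} (h : x ∈ SigmaSet n lam) :
    (fun k l => if 1 ≤ k ∧ 1 ≤ l ∧ k + l ≤ n + 1 then x ((k - 1) * n + l) else 0) = fX n x := by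
  funext k l
  by_cases hv : 1 ≤ k ∧ 1 ≤ l ∧ k + l ≤ n + 1
  · rw [if_pos hv]; unfold fX; rw [if_pos (by omega)]
  · rw [if_neg hv]
    by_cases hl : l ≤ n + 1 ∧ n + 1 < k + l
    · exact (fX_vanish hn lam h (n + 1 - l) k l (by omega) hl.2).symm
    · unfold fX; rw [if_neg (by omega)]

theorem B_iff {n : ℕ} (lam : ℕ → ℕ) (y : ℕ → ℕ → ℤ)
    (hy : ∀ k l, (k = 0 ∨ l = 0 ∨ n + 1 < k + l) → y k l = 0) :
    y ∈ BfB n lam ↔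
      (∀ l m, 1 ≤ l → m ≤ n → y (l + 1) m ≤ y l (m + 1)) ∧
      (∀ i k, 1 ≤ k → k ≤ i → i ≤ n →
        0 ≤ (lam i : ℤ) + (y k (i - k) - y k (i - k + 1))) := by
  constructor
  · rintro ⟨-, h⟩
    constructor
    · intro l m hl hm
      by_cases hlm : l + m ≤ n
      · have := (h (n + 1 - l) (by omega) (by omega)).1
        rw [Finset.le_inf'_iff] at this
        have := this (m + 1) (by simp; omega)
        have e1 : n - (n + 1 - l) + 1 = l := by omega
        have e2 : n - (n + 1 - l) + 2 = l + 1 := by omega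
        rw [e1, e2, Nat.add_sub_cancel] at this
        omega
      · rw [hy (l + 1) m (by omega), hy l (m + 1) (by omega)]
    · intro i k hk hki hi
      have := (h i (by omega) hi).2
      rw [← neg_le_iff_add_nonneg', Finset.le_inf'_iff] at this
      have := this (i - k + 1) (by simp; omega)
      have e1 : i - (i - k + 1) + 1 = k := by omega
      rw [e1, Nat.add_sub_cancel] at this
      omega
  · rintro ⟨h1, h2⟩
    refine ⟨hy, fun j hj hjn => ⟨?_, ?_⟩⟩
    · rw [Finset.le_inf'_iff]
      intro k hk
      rw [Finset.mem_Icc] at hk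
      have := h1 (n - j + 1) (k - 1) (by omega) (by omega)
      rw [Nat.sub_add_cancel hk.1] at this
      simpa using this
    · rw [← neg_le_iff_add_nonneg', Finset.le_inf'_iff]
      intro k hk
      rw [Finset.mem_Icc] at hk
      have := h2 j (j - k + 1) (by omega) (by omega) hjn
      have e1 : j - (j - k + 1) = k - 1 := by omega
      rw [e1, Nat.sub_add_cancel hk.1] at this
      omega

end PR

/-- The map `x ↦ (x_{j;i})_{i+j≤n+1}`, `x_{j;i} = x_{(j−1)n+i}`, is a bijection from the
polyhedral realization `Σ_ι[λ]` onto `B_{f_B}(λ)`: the underlying set identification of the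
crystal isomorphism `B_{f_B,Θ⁻_{𝐢₀}}[λ] ≅ Σ_{ι₀}[λ]`. -/
theorem stmt15 (n : ℕ) (hn : 1 ≤ n) (lam : ℕ → ℕ) :
    Set.BijOn
      (fun (x : ℕ → ℤ) => fun k l =>
        if 1 ≤ k ∧ 1 ≤ l ∧ k + l ≤ n + 1 then x ((k - 1) * n + l) else 0)
      (SigmaSet n lam) (BfB n lam) := by
  refine ⟨?_, ?_, ?_⟩
  · intro x hx
    have e := PR.map_eq hn lam hx
    dsimp only at e ⊢
    rw [e]
    refine (PR.B_iff lam _ ?_).2 ((PR.sigma_iff hn lam x hx.1 hx.2.1).1 hx)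
    intro k l h
    by_cases hl : l ≤ n + 1 ∧ n + 1 < k + l
    · exact PR.fX_vanish hn lam hx (n + 1 - l) k l (by omega) hl.2
    · unfold PR.fX; rw [if_neg (by omega)]
  · intro x hx x' hx' h
    have e := PR.map_eq hn lam hx
    have e' := PR.map_eq hn lam hx'
    dsimp only at h e e'
    rw [e, e'] at h
    funext k
    rcases Nat.eq_zero_or_pos k with hk | hk
    · rw [hk, hx.1, hx'.1]
    · obtain ⟨l, m, hl, hm, hmn, rfl⟩ := PR.exists_idx hn hk
      have := congrFun (congrFun h l) m
      simpa [PR.fX, hl, hm, hmn] using this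
  · intro y hy
    have hy0 := hy.1
    set x : ℕ → ℤ := fun k => if k = 0 then 0 else y ((k - 1) / n + 1) ((k - 1) % n + 1) with hxdef
    have hfX : PR.fX n x = y := by
      funext l m
      unfold PR.fX
      split_ifs with hv
      · have e1 : (l - 1) * n + m - 1 = (m - 1) + (l - 1) * n := by omega
        rw [hxdef]
        dsimp only
        rw [if_neg (by omega), e1, Nat.add_mul_div_right _ _ (by omega),
          Nat.add_mul_mod_self_right, Nat.mod_eq_of_lt (by omega), Nat.div_eq_of_lt (by omega)]
        congr 1 <;> omega
      · exact (hy0 l m (by omega)).symm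
    have hfin : (Function.support x).Finite := by
      apply (Set.finite_Iic (n * n)).subset
      intro k hk
      rw [Function.mem_support] at hk
      by_contra hkn
      apply hk
      rw [Set.mem_Iic] at hkn
      rw [hxdef]
      dsimp only
      rw [if_neg (by omega)]
      apply hy0
      have : n ≤ (k - 1) / n := (Nat.le_div_iff_mul_le (by omega)).2 (by omega)
      omega
    have hxS : x ∈ SigmaSet n lam := by
      rw [PR.sigma_iff hn lam x (by simp [hxdef]) hfin, hfX]
      exact (PR.B_iff lam y hy0).1 hy
    refine ⟨x, hxS, ?_⟩
    have e := PR.map_eq hn lam hxS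
    dsimp only at e ⊢
    rw [e, hfX]
end
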